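/- Let S be the endomorphism field on ℝⁿ × ℝⁿ with S(∂/∂xⁱ) = ∂/∂yⁱ, S(∂/∂yⁱ) = 0, and let ω be a 2-form satisfying ω(X, SY) = ω(Y, SX) for all vector fields X, Y. If ω = ω_L for a smooth L, this compatibility holds automatically; conversely, for a closed 2-form ω with ω(X,SY) = ω(Y,SX) and ω(SX, SY) = 0, locally there exists a function L with ω = ω_L. -/

import Mathlib

/-- The Lagrangian 2-form `ω_L = dθ_L`, `θ_L = Σ (∂L/∂yⁱ) dxⁱ`, evaluated at `p` on
constant vectors `u, v`. -/
noncomputable def omegaL (n : ℕ) (L : ((Fin n → ℝ) × (Fin n → ℝ)) → ℝ)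
    (p u v : (Fin n → ℝ) × (Fin n → ℝ)) : ℝ :=
  fderiv ℝ (fun q => ∑ j : Fin n,
    fderiv ℝ L q ((0 : Fin n → ℝ), Pi.single j (1 : ℝ)) * v.1 j) p u -
  fderiv ℝ (fun q => ∑ j : Fin n,
    fderiv ℝ L q ((0 : Fin n → ℝ), Pi.single j (1 : ℝ)) * u.1 j) p v

section AuxLemmas

open scoped ContDiff

theorem aux_param_hasFDerivAt {E F : Type} [NormedAddCommGroup E] [NormedSpace ℝ E]
    [FiniteDimensional ℝ E] [NormedAddCommGroup F] [NormedSpace ℝ F]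
    (f : E → ℝ → F) (f' : E → ℝ → E →L[ℝ] F) (hf : Continuous f.uncurry)
    (hf' : Continuous f'.uncurry)
    (h : ∀ x t, HasFDerivAt (fun y => f y t) (f' x t) x) (x : E) :
    HasFDerivAt (fun y => ∫ t in (0:ℝ)..1, f y t) (∫ t in (0:ℝ)..1, f' x t) x := by
  have : ProperSpace E := FiniteDimensional.proper ℝ E
  have hK : IsCompact (Metric.closedBall x 1 ×ˢ Set.Icc (0:ℝ) 1) :=
    (isCompact_closedBall x 1).prod isCompact_Icc
  obtain ⟨C, hC⟩ := hK.exists_bound_of_continuousOn hf'.continuousOn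
  refine intervalIntegral.hasFDerivAt_integral_of_dominated_of_fderiv_le
    (bound := fun _ => C) (s := Metric.closedBall x 1) (F' := f')
    (Metric.closedBall_mem_nhds x one_pos) ?_ ?_ ?_ ?_ ?_ ?_
  · refine Filter.Eventually.of_forall fun y => ?_
    have : Continuous (f y) := hf.comp (by fun_prop : Continuous fun t => (y, t))
    exact this.aestronglyMeasurable
  · have : Continuous (f x) := hf.comp (by fun_prop : Continuous fun t => (x, t))
    exact this.intervalIntegrable _ _
  · have : Continuous (f' x) := hf'.comp (by fun_prop : Continuous fun t => (x, t))
    exact this.aestronglyMeasurable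
  · refine Filter.Eventually.of_forall fun t ht y hy => ?_
    rw [Set.uIoc_of_le zero_le_one] at ht
    exact hC (y, t) ⟨hy, ht.1.le, ht.2⟩
  · exact intervalIntegrable_const
  · exact Filter.Eventually.of_forall fun t _ y _ => h y t

theorem aux_partial {E F : Type} [NormedAddCommGroup E] [NormedSpace ℝ E]
    [NormedAddCommGroup F] [NormedSpace ℝ F] {n : WithTop ℕ∞}
    (f : E → ℝ → F) (hf : ContDiff ℝ (n + 1) f.uncurry) :
    ContDiff ℝ n (fun p : E × ℝ => fderiv ℝ (fun y => f y p.2) p.1) := by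
  refine ContDiff.fderiv (m := n + 1) (n := n) (f := fun (p : E × ℝ) y => f y p.2)
    (g := fun p => p.1) ?_ contDiff_fst le_rfl
  exact hf.comp (by fun_prop : ContDiff ℝ (n+1) fun q : (E × ℝ) × E => (q.2, q.1.2))

theorem aux_param_hasFDerivAt' {E F : Type} [NormedAddCommGroup E] [NormedSpace ℝ E]
    [FiniteDimensional ℝ E] [NormedAddCommGroup F] [NormedSpace ℝ F]
    (f : E → ℝ → F) (hf : ContDiff ℝ 1 f.uncurry) (x : E) :
    HasFDerivAt (fun y => ∫ t in (0:ℝ)..1, f y t)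
      (∫ t in (0:ℝ)..1, fderiv ℝ (fun y => f y t) x) x := by
  refine aux_param_hasFDerivAt f (fun x t => fderiv ℝ (fun y => f y t) x) hf.continuous
    (aux_partial (n := 0) f (by simpa using hf)).continuous (fun x t => ?_) x
  have : ContDiff ℝ 1 (fun y => f y t) := hf.comp (by fun_prop : ContDiff ℝ 1 fun y : E => (y, t))
  exact (this.differentiable one_ne_zero x).hasFDerivAt

theorem aux_param_nat {E : Type} [NormedAddCommGroup E] [NormedSpace ℝ E]
    [FiniteDimensional ℝ E] (n : ℕ) : ∀ {F : Type} [NormedAddCommGroup F] [NormedSpace ℝ F]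
    (f : E → ℝ → F) (_ : ContDiff ℝ n f.uncurry),
    ContDiff ℝ n (fun y => ∫ t in (0:ℝ)..1, f y t) := by
  induction n with
  | zero =>
    intro F _ _ f hf
    have hf := hf.continuous
    exact contDiff_zero.2
      (intervalIntegral.continuous_parametric_intervalIntegral_of_continuous' hf 0 1)
  | succ n ih =>
    intro F _ _ f hf
    have h1 : ContDiff ℝ 1 f.uncurry := hf.of_le (by push_cast; exact le_add_self)
    push_cast at hf ⊢
    rw [contDiff_succ_iff_fderiv]
    refine ⟨fun x => (aux_param_hasFDerivAt' f h1 x).differentiableAt, by simp, ?_⟩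
    have : fderiv ℝ (fun y => ∫ t in (0:ℝ)..1, f y t) =
        fun x => ∫ t in (0:ℝ)..1, fderiv ℝ (fun y => f y t) x :=
      funext fun x => (aux_param_hasFDerivAt' f h1 x).fderiv
    rw [this]
    exact ih _ (aux_partial f hf)

theorem aux_param_smooth {E F : Type} [NormedAddCommGroup E] [NormedSpace ℝ E]
    [FiniteDimensional ℝ E] [NormedAddCommGroup F] [NormedSpace ℝ F]
    (f : E → ℝ → F) (hf : ContDiff ℝ ∞ f.uncurry) :
    ContDiff ℝ ∞ (fun y => ∫ t in (0:ℝ)..1, f y t) :=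
  contDiff_infty.2 fun n => aux_param_nat n f (contDiff_infty.1 hf n)

theorem aux_param_fderiv {E F : Type} [NormedAddCommGroup E] [NormedSpace ℝ E]
    [FiniteDimensional ℝ E] [NormedAddCommGroup F] [NormedSpace ℝ F] 
    (f : E → ℝ → F) (hf : ContDiff ℝ ∞ f.uncurry) (x u : E) :
    fderiv ℝ (fun y => ∫ t in (0:ℝ)..1, f y t) x u =
      ∫ t in (0:ℝ)..1, fderiv ℝ (fun y => f y t) x u := by
  have h1 : ContDiff ℝ 1 f.uncurry := hf.of_le (by exact_mod_cast le_top)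
  rw [(aux_param_hasFDerivAt' f h1 x).fderiv, ContinuousLinearMap.intervalIntegral_apply]
  have := (aux_partial (n := 0) f (by simpa using h1)).continuous
  exact (this.comp (by fun_prop : Continuous fun t : ℝ => (x, t))).intervalIntegrable _ _

theorem aux_param_cont {E F : Type} [NormedAddCommGroup E] [NormedSpace ℝ E]
    [NormedAddCommGroup F] [NormedSpace ℝ F] 
    (f : E → ℝ → F) (hf : ContDiff ℝ ∞ f.uncurry) (x u : E) :
    Continuous fun t => fderiv ℝ (fun y => f y t) x u := by
  have h1 : ContDiff ℝ 1 f.uncurry := hf.of_le (by exact_mod_cast le_top)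
  have := (aux_partial (n := 0) f (by simpa using h1)).continuous
  exact (this.comp (by fun_prop : Continuous fun t : ℝ => (x, t))).clm_apply continuous_const

/-- `h_t = P + t (1 - P)`. -/
noncomputable def auxH {E : Type} [NormedAddCommGroup E] [NormedSpace ℝ E] (P : E →L[ℝ] E) (t : ℝ) :
    E →L[ℝ] E := P + t • (ContinuousLinearMap.id ℝ E - P)

theorem aux_homotopy {E : Type} [NormedAddCommGroup E] [NormedSpace ℝ E]
    [FiniteDimensional ℝ E] (W : E → E →L[ℝ] E →L[ℝ] ℝ) (hW : ContDiff ℝ ∞ W)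
    (halt : ∀ p u v, W p u v = - W p v u)
    (hcl : ∀ p u v w, fderiv ℝ W p u v w + fderiv ℝ W p v w u + fderiv ℝ W p w u v = 0)
    (P : E →L[ℝ] E) :
    ∃ θ : E → E →L[ℝ] ℝ, ContDiff ℝ ∞ θ ∧
      (∀ p u v, fderiv ℝ θ p u v - fderiv ℝ θ p v u = W p u v - W (P p) (P u) (P v)) ∧
      (∀ p v, (∀ t : ℝ, W (auxH P t p) (p - P p) (auxH P t v) = 0) → θ p v = 0) := by
  have hH : ContDiff ℝ ∞ (auxH P) := by unfold auxH; fun_prop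
  set Q : E →L[ℝ] E := ContinuousLinearMap.id ℝ E - P with hQ
  let f : E → ℝ → (E →L[ℝ] ℝ) := fun p t => (W (auxH P t p) (Q p)).comp (auxH P t)
  have hf : ContDiff ℝ ∞ f.uncurry := by
    have h1 : ContDiff ℝ ∞ fun q : E × ℝ => auxH P q.2 := hH.comp contDiff_snd
    have h2 : ContDiff ℝ ∞ fun q : E × ℝ => auxH P q.2 q.1 := h1.clm_apply contDiff_fst
    have h3 : ContDiff ℝ ∞ fun q : E × ℝ => W (auxH P q.2 q.1) := hW.comp h2
    have h4 : ContDiff ℝ ∞ fun q : E × ℝ => Q q.1 := by fun_prop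
    exact (h3.clm_apply h4).clm_comp h1
  have hWd : ∀ p, HasFDerivAt W (fderiv ℝ W p) p := fun p =>
    (hW.differentiable (by simp) p).hasFDerivAt
  have hfd : ∀ t p u v, fderiv ℝ (fun y => f y t) p u v =
      fderiv ℝ W (auxH P t p) (auxH P t u) (Q p) (auxH P t v) +
        W (auxH P t p) (Q u) (auxH P t v) := by
    intro t p u v
    have h1 : HasFDerivAt (fun y => W (auxH P t y)) ((fderiv ℝ W (auxH P t p)).comp (auxH P t)) p :=
      HasFDerivAt.comp (g := W) p (hWd (auxH P t p)) (auxH P t).hasFDerivAt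
    have h2 := (h1.clm_apply Q.hasFDerivAt).clm_comp (hasFDerivAt_const (auxH P t) p)
    rw [show fderiv ℝ (fun y => f y t) p = _ from h2.fderiv]
    simp
    ring
  have hanti : ∀ (p a b c : E), fderiv ℝ W p a b c = - fderiv ℝ W p a c b := by
    intro p a b c
    have e : (fun q => W q b c) = fun q => - W q c b := funext fun q => halt q b c
    have h1 : HasFDerivAt (fun q => W q b c) _ p :=
      ((hWd p).clm_apply (hasFDerivAt_const b p)).clm_apply (hasFDerivAt_const c p)
    have h2 : HasFDerivAt (fun q => - W q c b) _ p :=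
      (((hWd p).clm_apply (hasFDerivAt_const c p)).clm_apply (hasFDerivAt_const b p)).neg
    rw [e] at h1
    have := congrArg (fun l => l a) (h1.unique h2)
    simpa using this
  refine ⟨fun p => ∫ t in (0:ℝ)..1, f p t, aux_param_smooth f hf, ?_, ?_⟩
  · intro p u v
    have hc : ∀ u v, Continuous fun t => fderiv ℝ (fun y => f y t) p u v := fun u v =>
      (aux_param_cont f hf p u).clm_apply continuous_const
    have ev : ∀ u v, fderiv ℝ (fun p => ∫ t in (0:ℝ)..1, f p t) p u v =
        ∫ t in (0:ℝ)..1, fderiv ℝ (fun y => f y t) p u v := by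
      intro u v
      rw [aux_param_fderiv f hf, ContinuousLinearMap.intervalIntegral_apply]
      exact (aux_param_cont f hf p u).intervalIntegrable _ _
    rw [ev, ev, ← intervalIntegral.integral_sub ((hc u v).intervalIntegrable _ _)
      ((hc v u).intervalIntegrable _ _)]
    have hder : ∀ t : ℝ, HasDerivAt (fun t => W (auxH P t p) (auxH P t u) (auxH P t v))
        (fderiv ℝ (fun y => f y t) p u v - fderiv ℝ (fun y => f y t) p v u) t := by
      intro t
      have hh : ∀ x : E, HasDerivAt (fun t => auxH P t x) (Q x) t := by
        intro x
        have : HasDerivAt (fun t : ℝ => P x + t • Q x) ((1:ℝ) • Q x) t :=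
          ((hasDerivAt_id t).smul_const (Q x)).const_add (P x)
        simpa [auxH, hQ] using this
      have h1 : HasDerivAt (fun t => W (auxH P t p)) (fderiv ℝ W (auxH P t p) (Q p)) t :=
        HasFDerivAt.comp_hasDerivAt (l := W) t (hWd (auxH P t p)) (hh p)
      have h2 := (h1.clm_apply (hh u)).clm_apply (hh v)
      refine h2.congr_deriv ?_
      rw [hfd, hfd]
      have c1 := hcl (auxH P t p) (auxH P t u) (Q p) (auxH P t v)
      have c2 := hanti (auxH P t p) (Q p) (auxH P t u) (auxH P t v)
      have c3 := hanti (auxH P t p) (auxH P t v) (Q p) (auxH P t u)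
      have c4 := halt (auxH P t p) (Q v) (auxH P t u)
      simp only [add_apply]
      linarith
    rw [intervalIntegral.integral_eq_sub_of_hasDerivAt (fun t _ => hder t)
      (((hc u v).sub (hc v u)).intervalIntegrable _ _)]
    simp [auxH]
  · intro p v h
    have hc : Continuous (f p) := hf.continuous.comp (by fun_prop : Continuous fun t : ℝ => (p, t))
    change (∫ t in (0:ℝ)..1, f p t) v = 0
    rw [ContinuousLinearMap.intervalIntegral_apply (hc.intervalIntegrable _ _)]
    have : ∀ t, f p t v = 0 := h
    simp [this]

theorem aux_eval {E : Type} [NormedAddCommGroup E] [NormedSpace ℝ E]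
    (W : E → E →L[ℝ] E →L[ℝ] ℝ) (hW : ContDiff ℝ ∞ W) (p u v w : E) :
    fderiv ℝ W p u v w = fderiv ℝ (fun q => W q v w) p u := by
  have hd : HasFDerivAt W (fderiv ℝ W p) p := (hW.differentiable (by simp) p).hasFDerivAt
  have h1 : HasFDerivAt (fun q => W q v w) _ p :=
    (hd.clm_apply (hasFDerivAt_const v p)).clm_apply (hasFDerivAt_const w p)
  rw [h1.fderiv]
  simp

theorem aux_eval1 {E F : Type} [NormedAddCommGroup E] [NormedSpace ℝ E]
    [NormedAddCommGroup F] [NormedSpace ℝ F]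
    (W : E → F →L[ℝ] ℝ) (hW : ContDiff ℝ ∞ W) (p u : E) (v : F) :
    fderiv ℝ W p u v = fderiv ℝ (fun q => W q v) p u := by
  have hd : HasFDerivAt W (fderiv ℝ W p) p := (hW.differentiable (by simp) p).hasFDerivAt
  have h1 : HasFDerivAt (fun q => W q v) _ p :=
    (hd.clm_apply (hasFDerivAt_const v p))
  rw [h1.fderiv]
  simp

/-- A closed 2-form isotropic on the vertical fibres has a horizontal potential. -/
theorem aux_horizontal {X : Type} [NormedAddCommGroup X] [NormedSpace ℝ X]
    [FiniteDimensional ℝ X] (W : X × X → X × X →L[ℝ] X × X →L[ℝ] ℝ) (hW : ContDiff ℝ ∞ W)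
    (halt : ∀ p u v, W p u v = - W p v u)
    (hcl : ∀ p u v w, fderiv ℝ W p u v w + fderiv ℝ W p v w u + fderiv ℝ W p w u v = 0)
    (hvert : ∀ p a b, W p (0, a) (0, b) = 0) :
    ∃ θ : X × X → X × X →L[ℝ] ℝ, ContDiff ℝ ∞ θ ∧
      (∀ p u v, fderiv ℝ θ p u v - fderiv ℝ θ p v u = W p u v) ∧
      (∀ p b, θ p (0, b) = 0) := by
  let P : X × X →L[ℝ] X × X :=
    (ContinuousLinearMap.inl ℝ X X).comp (ContinuousLinearMap.fst ℝ X X)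
  have hP : ∀ p, P p = (p.1, 0) := fun p => rfl
  obtain ⟨θ₁, h1s, h1d, h1z⟩ := aux_homotopy W hW halt hcl P
  let W2 : X × X → X × X →L[ℝ] X × X →L[ℝ] ℝ := fun p => (W (P p)).bilinearComp P P
  have hW2e : ∀ p u v, W2 p u v = W (P p) (P u) (P v) := fun p u v => rfl
  have hW2 : ContDiff ℝ ∞ W2 := by
    refine contDiff_clm_apply_iff.2 fun u => contDiff_clm_apply_iff.2 fun v => ?_
    simp only [hW2e]
    exact ((hW.comp P.contDiff).clm_apply contDiff_const).clm_apply contDiff_const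
  have hW2d : ∀ p u v w, fderiv ℝ W2 p u v w = fderiv ℝ W (P p) (P u) (P v) (P w) := by
    intro p u v w
    rw [aux_eval W2 hW2, aux_eval W hW]
    have hd : DifferentiableAt ℝ (fun q => W q (P v) (P w)) (P p) :=
      ((hW.clm_apply contDiff_const).clm_apply contDiff_const).differentiable (by simp) _
    have := HasFDerivAt.comp (g := fun q => W q (P v) (P w)) p hd.hasFDerivAt P.hasFDerivAt
    rw [show fderiv ℝ (fun q => W2 q v w) p = _ from this.fderiv]
    rfl
  obtain ⟨θ₂, h2s, h2d, h2z⟩ := aux_homotopy W2 hW2 (fun p u v => by simp only [hW2e]; exact halt _ _ _)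
    (fun p u v w => by simp only [hW2d]; exact hcl _ _ _ _) 0
  refine ⟨fun p => θ₁ p + θ₂ p, h1s.add h2s, ?_, ?_⟩
  · intro p u v
    rw [fderiv_fun_add (h1s.differentiable (by simp) p) (h2s.differentiable (by simp) p)]
    have e1 := h1d p u v
    have e2 := h2d p u v
    have e3 : W2 p u v = W (P p) (P u) (P v) := rfl
    simp only [add_apply, zero_apply, map_zero] at e2 ⊢
    linarith
  · intro p b
    have e1 : θ₁ p (0, b) = 0 := by
      refine h1z p _ fun t => ?_
      have a1 : p - P p = (0, p.2) := by rw [hP]; ext <;> simp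
      have a2 : auxH P t (0, b) = (0, t • b) := by simp [auxH, hP]
      rw [a1, a2]
      exact hvert _ _ _
    have e2 : θ₂ p (0, b) = 0 := by
      refine h2z p _ fun t => ?_
      have a2 : P (auxH 0 t (0, b)) = 0 := by simp [auxH, hP]
      rw [hW2e, a2, map_zero]
    simp [e1, e2]

/-- A horizontal 1-form with symmetric fibre derivative is the fibre derivative of a function. -/
theorem aux_lagrangian {X : Type} [NormedAddCommGroup X] [NormedSpace ℝ X]
    [FiniteDimensional ℝ X] (θ : X × X → X × X →L[ℝ] ℝ) (hθ : ContDiff ℝ ∞ θ)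
    (hsym : ∀ p a b, fderiv ℝ θ p (0, a) (b, 0) = fderiv ℝ θ p (0, b) (a, 0)) :
    ∃ L : X × X → ℝ, ContDiff ℝ ∞ L ∧ ∀ p b, fderiv ℝ L p (0, b) = θ p (b, 0) := by
  let f : X × X → ℝ → ℝ := fun p t => θ (p.1, t • p.2) (p.2, 0)
  have hf : ContDiff ℝ ∞ f.uncurry := by
    have h2 : ContDiff ℝ ∞ fun q : (X × X) × ℝ => (q.1.1, q.2 • q.1.2) := by fun_prop
    have h3 : ContDiff ℝ ∞ fun q : (X × X) × ℝ => θ (q.1.1, q.2 • q.1.2) := hθ.comp h2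
    have h4 : ContDiff ℝ ∞ fun q : (X × X) × ℝ => (q.1.2, (0 : X)) := by fun_prop
    exact h3.clm_apply h4
  have hd : ∀ p, HasFDerivAt θ (fderiv ℝ θ p) p := fun p =>
    (hθ.differentiable (by simp) p).hasFDerivAt
  refine ⟨fun p => ∫ t in (0:ℝ)..1, f p t, aux_param_smooth f hf, fun p b => ?_⟩
  rw [aux_param_fderiv f hf]
  have hder : ∀ t : ℝ, HasDerivAt (fun t : ℝ => t • θ (p.1, t • p.2) (b, 0))
      (fderiv ℝ (fun y => f y t) p (0, b)) t := by
    intro t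
    have g1 : HasDerivAt (fun t : ℝ => (p.1, t • p.2)) ((0 : X), (1:ℝ) • p.2) t :=
      (hasDerivAt_const t p.1).prodMk ((hasDerivAt_id t).smul_const p.2)
    have g2 : HasDerivAt (fun t : ℝ => θ (p.1, t • p.2)) _ t :=
      HasFDerivAt.comp_hasDerivAt (l := θ) t (hd (p.1, t • p.2)) g1
    have g3 := (hasDerivAt_id t).smul (g2.clm_apply (hasDerivAt_const t ((b, 0) : X × X)))
    refine g3.congr_deriv ?_
    let A : X × X →L[ℝ] X × X :=
      (ContinuousLinearMap.fst ℝ X X).prod (t • ContinuousLinearMap.snd ℝ X X)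
    let B : X × X →L[ℝ] X × X :=
      (ContinuousLinearMap.snd ℝ X X).prod 0
    have k1 : HasFDerivAt (fun y : X × X => θ (A y)) ((fderiv ℝ θ (A p)).comp A) p :=
      HasFDerivAt.comp (g := θ) p (hd (A p)) A.hasFDerivAt
    have k2 := k1.clm_apply B.hasFDerivAt
    rw [show fderiv ℝ (fun y => f y t) p = _ from k2.fderiv]
    have s1 := hsym (A p) p.2 b
    have s2 : A (0, b) = t • ((0, b) : X × X) := by simp [A]
    have s3 : B (0, b) = (b, 0) := by simp [B]
    have s4 : B p = (p.2, 0) := by simp [B]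
    have s5 : A p = (p.1, t • p.2) := by simp [A]
    simp only [add_apply, ContinuousLinearMap.comp_apply,
      ContinuousLinearMap.flip_apply, s2, s3, s4, map_smul, smul_apply, ← s1]
    simp [s5]
    try ring
  rw [intervalIntegral.integral_eq_sub_of_hasDerivAt (fun t _ => hder t)
    ((aux_param_cont f hf p (0, b)).intervalIntegrable _ _)]
  simp

theorem aux_sum (n : ℕ) (l : (Fin n → ℝ) × (Fin n → ℝ) →L[ℝ] ℝ) (v : Fin n → ℝ) :
    ∑ j : Fin n, l ((0 : Fin n → ℝ), Pi.single j (1 : ℝ)) * v j = l (0, v) := by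
  have h : v = ∑ j, v j • (Pi.single j (1 : ℝ) : Fin n → ℝ) := pi_eq_sum_univ' v
  have := map_sum (l.comp (ContinuousLinearMap.inr ℝ (Fin n → ℝ) (Fin n → ℝ)))
    (fun j => v j • (Pi.single j (1 : ℝ) : Fin n → ℝ)) Finset.univ
  rw [← h] at this
  simp only [ContinuousLinearMap.comp_apply, ContinuousLinearMap.inr_apply] at this
  rw [this]
  refine Finset.sum_congr rfl fun j _ => ?_
  have e : ((0 : Fin n → ℝ), v j • (Pi.single j (1 : ℝ) : Fin n → ℝ)) =
    v j • ((0 : Fin n → ℝ), (Pi.single j (1 : ℝ) : Fin n → ℝ)) := by simp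
  rw [e, map_smul, smul_eq_mul, mul_comm]

theorem aux_omegaL (n : ℕ) (L : ((Fin n → ℝ) × (Fin n → ℝ)) → ℝ)
    (p u v : (Fin n → ℝ) × (Fin n → ℝ)) :
    omegaL n L p u v = fderiv ℝ (fun q => fderiv ℝ L q (0, v.1)) p u -
      fderiv ℝ (fun q => fderiv ℝ L q (0, u.1)) p v := by
  simp only [omegaL, aux_sum]



end AuxLemmas

/-- For the standard tangent structure `S(∂/∂xⁱ) = ∂/∂yⁱ, S(∂/∂yⁱ) = 0` on `ℝⁿ × ℝⁿ`:
any `ω_L` satisfies the compatibility `ω_L(X,SY) = ω_L(Y,SX)`; conversely, a closed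
2-form `ω` with `ω(X,SY) = ω(Y,SX)` and `ω(SX,SY) = 0` is locally of the form `ω_L`. -/
theorem stmt19 (n : ℕ)
    (S : ((Fin n → ℝ) × (Fin n → ℝ)) →ₗ[ℝ] ((Fin n → ℝ) × (Fin n → ℝ)))
    (hS : ∀ u, S u = ((0 : Fin n → ℝ), u.1)) :
    (∀ L : ((Fin n → ℝ) × (Fin n → ℝ)) → ℝ, ContDiff ℝ (⊤ : ℕ∞) L →
      ∀ p u v, omegaL n L p u (S v) = omegaL n L p v (S u)) ∧
    (∀ ω : ((Fin n → ℝ) × (Fin n → ℝ)) →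
        ((Fin n → ℝ) × (Fin n → ℝ)) →ₗ[ℝ] ((Fin n → ℝ) × (Fin n → ℝ)) →ₗ[ℝ] ℝ,
      (∀ p u v, ω p u v = -ω p v u) →
      (∀ u v, ContDiff ℝ (⊤ : ℕ∞) (fun p => ω p u v)) →
      (∀ p u v w, fderiv ℝ (fun q => ω q v w) p u + fderiv ℝ (fun q => ω q w u) p v +
        fderiv ℝ (fun q => ω q u v) p w = 0) →
      (∀ p u v, ω p u (S v) = ω p v (S u)) →
      (∀ p u v, ω p (S u) (S v) = 0) →
      ∀ p, ∃ V : Set ((Fin n → ℝ) × (Fin n → ℝ)), IsOpen V ∧ p ∈ V ∧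
        ∃ L : ((Fin n → ℝ) × (Fin n → ℝ)) → ℝ, ContDiffOn ℝ (⊤ : ℕ∞) L V ∧
          ∀ q ∈ V, ∀ u v, ω q u v = omegaL n L q u v) := by
  refine ⟨?_, ?_⟩
  · intro L hL p u v
    have hL' : ContDiff ℝ (⊤ : ℕ∞) (fderiv ℝ L) := hL.fderiv_right (by simp)
    rw [aux_omegaL, aux_omegaL, hS, hS]
    have z : ∀ q, fderiv ℝ L q ((0 : Fin n → ℝ), (0 : Fin n → ℝ)) = 0 := fun q =>
      (fderiv ℝ L q).map_zero
    simp only [z]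
    rw [← aux_eval1 _ hL', ← aux_eval1 _ hL']
    have hs : IsSymmSndFDerivAt ℝ L p :=
      hL.contDiffAt.isSymmSndFDerivAt (by
        rw [minSmoothness_of_isRCLikeNormedField]
        exact WithTop.coe_le_coe.2 (le_top : (2 : ℕ∞) ≤ ⊤))
    rw [hs.eq]
    simp
  · intro ω halt hsm hcl hcompat hSS p
    let W : ((Fin n → ℝ) × (Fin n → ℝ)) → ((Fin n → ℝ) × (Fin n → ℝ)) →L[ℝ]
        ((Fin n → ℝ) × (Fin n → ℝ)) →L[ℝ] ℝ := fun q =>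
      LinearMap.toContinuousLinearMap
        ((LinearMap.toContinuousLinearMap :
          (((Fin n → ℝ) × (Fin n → ℝ)) →ₗ[ℝ] ℝ) ≃ₗ[ℝ] _).toLinearMap ∘ₗ ω q)
    have hWe : ∀ q u v, W q u v = ω q u v := fun q u v => rfl
    have hW : ContDiff ℝ (⊤ : ℕ∞) W :=
      contDiff_clm_apply_iff.2 fun u => contDiff_clm_apply_iff.2 fun v => hsm u v
    obtain ⟨θ, hθ, hd, hz⟩ := aux_horizontal W hW (fun q u v => halt q u v)
      (fun q u v w => by
        rw [aux_eval W hW, aux_eval W hW, aux_eval W hW]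
        exact hcl q u v w)
      (fun q a b => by
        have := hSS q (a, 0) (b, 0)
        rwa [hS, hS] at this)
    have hz' : ∀ q u b, fderiv ℝ θ q u (0, b) = 0 := by
      intro q u b
      rw [aux_eval1 θ hθ]
      simp [hz]
    obtain ⟨L, hL, hLd⟩ := aux_lagrangian θ hθ (fun q a b => by
      have e1 := hd q (0, a) (b, 0)
      have e2 := hd q (0, b) (a, 0)
      rw [hz', hWe, halt] at e1 e2
      have e3 := hcompat q (a, 0) (b, 0)
      rw [hS, hS] at e3
      simp only at e3
      linarith)
    refine ⟨Set.univ, isOpen_univ, Set.mem_univ _, L, hL.contDiffOn, fun q _ u v => ?_⟩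
    rw [aux_omegaL]
    simp only [hLd]
    rw [← aux_eval1 θ hθ, ← aux_eval1 θ hθ, ← hWe, ← hd]
    have e : ∀ u v : (Fin n → ℝ) × (Fin n → ℝ), fderiv ℝ θ q u v = fderiv ℝ θ q u (v.1, 0) := by
      intro u v
      have : v = (v.1, 0) + (0, v.2) := by simp
      conv_lhs => rw [this, map_add, hz', add_zero]
    rw [e u v, e v u]
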